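/- The property of being of type FC is invariant under elementary twists: if S is a Coxeter generating set of type FC of a group W and τ is an elementary twist in ⟨J⟩ for an irreducible spherical J weakly separating S, then τ(S) is a Coxeter generating set of W of type FC. -/

import Mathlib

open scoped Classical

variable {B W : Type} [Group W]

/-- A subset `J` of the index set is spherical if the standard parabolic subgroup it
generates is finite. -/
def SphericalIdx {M : CoxeterMatrix B} (cs : CoxeterSystem M W) (J : Set B) : Prop :=
  Set.Finite ((Subgroup.closure (cs.simple '' J) : Subgroup W) : Set W)

/-- A Coxeter system is of type FC if every subset of pairwise adjacent indices
(pairs generating finite dihedral groups, i.e. `M a b ≠ 0` for `a ≠ b`) is spherical. -/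
def IsFC {M : CoxeterMatrix B} (cs : CoxeterSystem M W) : Prop :=
  ∀ J : Set B, (∀ a ∈ J, ∀ b ∈ J, a ≠ b → M a b ≠ 0) → SphericalIdx cs J

/-- `J^⊥` at the level of the index set: indices outside `J` commuting with all of `J`. -/
def perpIdx (M : CoxeterMatrix B) (J : Set B) : Set B :=
  {a | a ∉ J ∧ ∀ j ∈ J, M a j = 2}

/-- `J` is irreducible: not contained in `K ∪ K^⊥` for non-empty proper `K ⊂ J`. -/
def IrredIdx (M : CoxeterMatrix B) (J : Set B) : Prop :=
  ∀ K : Set B, K ⊂ J → K.Nonempty → ¬ J ⊆ K ∪ perpIdx M K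

namespace FCTwist

/-- Chebyshev-like coefficients describing dihedral orbits. -/
noncomputable def coefU (m n : ℕ) : ℝ :=
  if m = 0 then (n : ℝ) else Real.sin (n * (Real.pi / m)) / Real.sin (Real.pi / m)

lemma sin_pos_of_two_le {m : ℕ} (hm : 2 ≤ m) : 0 < Real.sin (Real.pi / m) := by
  have h2 : (2 : ℝ) ≤ m := by exact_mod_cast hm
  apply Real.sin_pos_of_pos_of_lt_pi
  · exact div_pos Real.pi_pos (by linarith)
  · rw [div_lt_iff₀ (by linarith)]
    nlinarith [Real.pi_pos]

lemma coefU_zero (m : ℕ) : coefU m 0 = 0 := by simp [coefU]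

lemma coefU_one {m : ℕ} (hm : m ≠ 1) : coefU m 1 = 1 := by
  unfold coefU
  split_ifs with h
  · simp
  · have := sin_pos_of_two_le (m := m) (by omega)
    simp [this.ne']

lemma coefU_rec (m n : ℕ) :
    coefU m (n + 2) = 2 * Real.cos (Real.pi / m) * coefU m (n + 1) - coefU m n := by
  unfold coefU
  split_ifs with h
  · subst h; simp; ring
  · rw [← mul_div_assoc (2 * Real.cos _), ← sub_div]
    congr 1
    set x := Real.pi / m
    have e1 : ((n + 2 : ℕ) : ℝ) * x = (n + 1 : ℕ) * x + x := by push_cast; ring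
    have e2 : (n : ℝ) * x = (n + 1 : ℕ) * x - x := by push_cast; ring
    rw [e1, e2, Real.sin_add, Real.sin_sub]
    ring

lemma coefU_nonneg {m n : ℕ} (hm : m ≠ 1) (h : m = 0 ∨ n ≤ m) : 0 ≤ coefU m n := by
  unfold coefU
  split_ifs with h0
  · positivity
  · have := sin_pos_of_two_le (m := m) (by omega)
    have hn : (n : ℝ) ≤ m := by exact_mod_cast (h.resolve_left h0)
    have hmp : (0 : ℝ) < m := by exact_mod_cast Nat.pos_of_ne_zero h0
    refine div_nonneg (Real.sin_nonneg_of_nonneg_of_le_pi ?_ ?_) this.le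
    · have := Real.pi_pos; positivity
    · rw [mul_div_assoc', div_le_iff₀ hmp]
      nlinarith [Real.pi_pos]

lemma coefU_period {m : ℕ} (hm : 2 ≤ m) :
    coefU m (2 * m) = 0 ∧ coefU m (2 * m + 1) = 1 := by
  have := sin_pos_of_two_le hm
  have hmp : (m : ℝ) ≠ 0 := by
    have : m ≠ 0 := by omega
    exact_mod_cast this
  unfold coefU
  rw [if_neg (by omega), if_neg (by omega)]
  have e1 : ((2 * m : ℕ) : ℝ) * (Real.pi / m) = 2 * Real.pi := by
    push_cast; field_simp
  have e2 : ((2 * m + 1 : ℕ) : ℝ) * (Real.pi / m) = Real.pi / m + 2 * Real.pi := by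
    push_cast; field_simp; ring
  rw [e1, e2, Real.sin_add_two_pi, Real.sin_two_pi]
  simp [this.ne']

lemma dvd_of_coefU {m k : ℕ} (hm : m ≠ 1) (h0 : coefU m (2 * k) = 0)
    (h1 : coefU m (2 * k + 1) = 1) : m ∣ k := by
  unfold coefU at h0 h1
  split_ifs at h0 h1 with h
  · have : k = 0 := by
      have : 2 * k = 0 := by exact_mod_cast h0
      omega
    simp [this]
  · have hs := sin_pos_of_two_le (m := m) (by omega)
    have hmp : (m : ℝ) ≠ 0 := by exact_mod_cast h
    rw [div_eq_zero_iff, or_iff_left hs.ne'] at h0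
    rw [div_eq_one_iff_eq hs.ne'] at h1
    have e2 : ((2 * k + 1 : ℕ) : ℝ) * (Real.pi / m)
      = ((2 * k : ℕ) : ℝ) * (Real.pi / m) + Real.pi / m := by push_cast; ring
    rw [e2, Real.sin_add, h0, zero_mul, zero_add, mul_eq_right₀ hs.ne',
      Real.cos_eq_one_iff] at h1
    obtain ⟨n, hn⟩ := h1
    have : (n : ℝ) * m = k := by
      have := Real.pi_pos
      push_cast at hn
      field_simp at hn
      nlinarith
    have : n * (m : ℤ) = k := by exact_mod_cast this
    have : (m : ℤ) ∣ (k : ℤ) := ⟨n, by rw [← this]; ring⟩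
    exact_mod_cast this

section Rep

variable (M : CoxeterMatrix B)

/-- Linear form of the geometric representation. -/
noncomputable def geomForm (i : B) : Module.Dual ℝ (B →₀ ℝ) :=
  Finsupp.linearCombination ℝ (fun j => -2 * Real.cos (Real.pi / M i j))

/-- Simple root. -/
noncomputable def root (i : B) : B →₀ ℝ := Finsupp.single i 1

lemma geomForm_root (i j : B) : geomForm M i (root j) = -2 * Real.cos (Real.pi / M i j) := by
  simp [geomForm, root]

lemma geomForm_self (i : B) : geomForm M i (root i) = 2 := by
  simp [geomForm_root]

/-- Simple reflection of the geometric representation. -/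
noncomputable def geomRefl (i : B) : Module.End ℝ (B →₀ ℝ) :=
  Module.preReflection (root i) (geomForm M i)

lemma geomRefl_apply (i : B) (v : B →₀ ℝ) :
    geomRefl M i v = v - geomForm M i v • root i := Module.preReflection_apply _ _ _

lemma geomRefl_root_self (i : B) : geomRefl M i (root i) = - root i :=
  Module.preReflection_apply_self (geomForm_self M i)

lemma geomRefl_mul_self (i : B) : geomRefl M i * geomRefl M i = 1 := by
  refine LinearMap.ext fun v => ?_
  exact Module.involutive_preReflection (geomForm_self M i) v

lemma geomRefl_root (i j : B) :
    geomRefl M i (root j) = root j + (2 * Real.cos (Real.pi / M i j)) • root i := by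
  rw [geomRefl_apply, geomForm_root, sub_eq_add_neg, ← neg_smul]; congr 2; ring

/-- One step of the dihedral orbit: apply the reflection of the root with coefficient `U n`. -/
lemma geomRefl_step (i j : B) (n : ℕ) :
    geomRefl M i (coefU (M i j) n • root i + coefU (M i j) (n + 1) • root j)
      = coefU (M i j) (n + 2) • root i + coefU (M i j) (n + 1) • root j := by
  rw [map_add, map_smul, map_smul, geomRefl_root_self, geomRefl_root, coefU_rec]
  module

lemma geomRefl_mul_pow_root (i j : B) (hij : i ≠ j) (k : ℕ) :
    ((geomRefl M j * geomRefl M i) ^ k) (root j)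
      = coefU (M i j) (2 * k) • root i + coefU (M i j) (2 * k + 1) • root j := by
  induction k with
  | zero => simp [coefU_zero, coefU_one (M.off_diagonal i j hij)]
  | succ k ih =>
    rw [pow_succ', Module.End.mul_apply, ih, Module.End.mul_apply, geomRefl_step]
    have := geomRefl_step M j i (2 * k + 1)
    rw [M.symmetric j i] at this
    rw [add_comm, this, add_comm]
    rfl

lemma geomRefl_liftable : M.IsLiftable (geomRefl M) := by
  intro i j
  rcases eq_or_ne i j with rfl | hij
  · simp [geomRefl_mul_self]
  rcases Nat.eq_zero_or_pos (M i j) with h0 | hpos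
  · simp [h0]
  have hm : 2 ≤ M i j := by
    have := M.off_diagonal i j hij
    omega
  have key : ∀ a b : B, a ≠ b → 2 ≤ M a b →
      ((geomRefl M b * geomRefl M a) ^ M a b) (root b) = root b := by
    intro a b hab h2
    rw [geomRefl_mul_pow_root M a b hab, (coefU_period h2).1, (coefU_period h2).2]
    simp
  have hinv : (geomRefl M i * geomRefl M j) ^ M i j * (geomRefl M j * geomRefl M i) ^ M i j = 1 := by
    have hc : Commute (geomRefl M i * geomRefl M j) (geomRefl M j * geomRefl M i) := by
      unfold Commute SemiconjBy
      rw [mul_assoc, ← mul_assoc (geomRefl M j) (geomRefl M j), geomRefl_mul_self, one_mul,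
        geomRefl_mul_self, mul_assoc, ← mul_assoc (geomRefl M i) (geomRefl M i),
        geomRefl_mul_self, one_mul, geomRefl_mul_self]
    rw [← hc.mul_pow, mul_assoc, ← mul_assoc (geomRefl M j) (geomRefl M j), geomRefl_mul_self,
      one_mul, geomRefl_mul_self, one_pow]
  set P := (geomRefl M i * geomRefl M j) ^ M i j with hP
  have hi : P (root i) = root i := by
    have := key j i hij.symm (by rwa [M.symmetric j i])
    rwa [M.symmetric j i] at this
  have hj : P (root j) = root j := by
    have h1 := key i j hij hm
    have h2 := LinearMap.congr_fun hinv (root j)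
    rw [Module.End.mul_apply, h1] at h2
    simpa using h2
  have hfix : ∀ v, geomForm M i v = 0 → geomForm M j v = 0 → P v = v := by
    intro v h1 h2
    have : (geomRefl M i * geomRefl M j) v = v := by
      rw [Module.End.mul_apply, geomRefl_apply M j, h2]
      simp [geomRefl_apply, h1]
    rw [hP]
    generalize M i j = k
    induction k with
    | zero => simp
    | succ k ih => rw [pow_succ, Module.End.mul_apply, this, ih]
  refine LinearMap.ext fun v => ?_
  set c := 2 * Real.cos (Real.pi / M i j) with hc
  have hD : 4 - c ^ 2 ≠ 0 := by
    have h1 := sin_pos_of_two_le hm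
    have h2 := Real.sin_sq_add_cos_sq (Real.pi / M i j)
    have : 4 - c ^ 2 = 4 * Real.sin (Real.pi / M i j) ^ 2 := by rw [hc]; linear_combination -4 * h2
    rw [this]
    positivity
  set x := geomForm M i v with hx
  set y := geomForm M j v with hy
  set a := (2 * x + c * y) / (4 - c ^ 2) with ha
  set b := (c * x + 2 * y) / (4 - c ^ 2) with hb
  have hij' : geomForm M i (root j) = -c := by rw [geomForm_root, hc]; ring
  have hji' : geomForm M j (root i) = -c := by rw [geomForm_root, M.symmetric j i, hc]; ring
  have hv := hfix (v - a • root i - b • root j)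
    (by
      rw [map_sub, map_sub, map_smul, map_smul, geomForm_self, hij', ← hx, ha, hb]
      simp only [smul_eq_mul]
      field_simp
      ring)
    (by
      rw [map_sub, map_sub, map_smul, map_smul, geomForm_self, hji', ← hy, ha, hb]
      simp only [smul_eq_mul]
      field_simp
      ring)
  rw [map_sub, map_sub, map_smul, map_smul, hi, hj] at hv
  simpa using hv


variable {M}

/-- The geometric representation. -/
noncomputable def geomRep (cs : CoxeterSystem M W) : W →* Module.End ℝ (B →₀ ℝ) :=
  cs.lift ⟨geomRefl M, geomRefl_liftable M⟩

lemma geomRep_simple (cs : CoxeterSystem M W) (i : B) :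
    geomRep cs (cs.simple i) = geomRefl M i :=
  cs.lift_apply_simple (geomRefl_liftable M) i

open CoxeterSystem in
lemma geomRep_alternatingWord (cs : CoxeterSystem M W) {i j : B} (hij : i ≠ j) (n : ℕ) :
    geomRep cs (cs.wordProd (alternatingWord i j n)) (root i) =
      if Even n then coefU (M i j) n • root j + coefU (M i j) (n + 1) • root i
      else coefU (M i j) (n + 1) • root j + coefU (M i j) n • root i := by
  induction n with
  | zero => simp [alternatingWord, coefU_zero, coefU_one (M.off_diagonal i j hij)]
  | succ n ih =>
    rw [alternatingWord_succ', wordProd_cons, map_mul, Module.End.mul_apply, ih, geomRep_simple]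
    by_cases h : Even n
    · have h' : ¬ Even (n + 1) := by simpa [Nat.even_add_one] using h
      simp only [h, h', if_true, if_false]
      have := geomRefl_step M j i n
      rwa [M.symmetric j i] at this
    · have h' : Even (n + 1) := by simpa [Nat.even_add_one] using h
      simp only [h, h', if_true, if_false]
      have := geomRefl_step M i j n
      rw [add_comm, this, add_comm]

open CoxeterSystem in
lemma geomRep_nonneg (cs : CoxeterSystem M W) (N : ℕ) : ∀ (w : W) (i : B), cs.length w = N →
    cs.length w < cs.length (w * cs.simple i) → 0 ≤ geomRep cs w (root i) := by
  induction N using Nat.strong_induction_on with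
  | _ N ih =>
  intro w i hN hlt
  by_cases hw : w = 1
  · subst hw
    simp [root]
  obtain ⟨j, hj⟩ := cs.exists_rightDescent_of_ne_one hw
  have hij : i ≠ j := by
    rintro rfl
    unfold IsRightDescent at hj
    omega
  let P : ℕ → Prop := fun n => ∃ v, w = v * cs.wordProd (alternatingWord i j n) ∧
    cs.length v + n = cs.length w
  have hP1 : P 1 := by
    refine ⟨w * cs.simple j, ?_, ?_⟩
    · simp [alternatingWord]
    · exact cs.isRightDescent_iff.1 hj
  have hlenpos : 1 ≤ cs.length w := by
    obtain ⟨v, _, hv⟩ := hP1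
    omega
  set n := Nat.findGreatest P (cs.length w) with hn
  have hn1 : 1 ≤ n := Nat.le_findGreatest hlenpos hP1
  have hPn : P n := Nat.findGreatest_spec hlenpos hP1
  have hPn1 : ¬ P (n + 1) := by
    intro h
    have hle : n + 1 ≤ cs.length w := by
      obtain ⟨v, _, hv⟩ := h
      omega
    have := Nat.le_findGreatest hle h
    omega
  obtain ⟨v, hv, hvl⟩ := hPn
  have hx : ¬ cs.IsRightDescent v (if Even n then j else i) := by
    intro h
    apply hPn1
    refine ⟨v * cs.simple (if Even n then j else i), ?_, ?_⟩
    · rw [alternatingWord_succ', wordProd_cons, mul_assoc, simple_mul_simple_cancel_left, hv]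
    · have := cs.isRightDescent_iff.1 h
      omega
  have hy : ¬ cs.IsRightDescent v (if Even n then i else j) := by
    intro h
    have h2 := cs.isRightDescent_iff.1 h
    obtain ⟨n', hn'⟩ : ∃ n', n = n' + 1 := ⟨n - 1, by omega⟩
    have hpar : (if Even n then i else j) = (if Even n' then j else i) := by
      rw [hn']
      by_cases he : Even n' <;> simp [Nat.even_add_one, he]
    rw [hpar] at h2
    have h3 : w = v * cs.simple (if Even n' then j else i) *
        cs.wordProd (alternatingWord i j n') := by
      rw [hv, hn', alternatingWord_succ', wordProd_cons, mul_assoc]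
    have h4 := cs.length_mul_le (v * cs.simple (if Even n' then j else i))
      (cs.wordProd (alternatingWord i j n'))
    have h5 := cs.length_wordProd_le (alternatingWord i j n')
    rw [length_alternatingWord] at h5
    rw [← h3] at h4
    omega
  have hi : ¬ cs.IsRightDescent v i := by
    by_cases he : Even n
    · simpa [he] using hy
    · simpa [he] using hx
  have hj' : ¬ cs.IsRightDescent v j := by
    by_cases he : Even n
    · simpa [he] using hx
    · simpa [he] using hy
  have ri : 0 ≤ geomRep cs v (root i) := by
    have := cs.not_isRightDescent_iff.1 hi
    exact ih (cs.length v) (by omega) v i rfl (by omega)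
  have rj : 0 ≤ geomRep cs v (root j) := by
    have := cs.not_isRightDescent_iff.1 hj'
    exact ih (cs.length v) (by omega) v j rfl (by omega)
  have hM : M i j = 0 ∨ n + 1 ≤ M i j := by
    by_contra! hcon
    have h1 : ¬ cs.IsReduced (alternatingWord j i (n + 1)) :=
      cs.not_isReduced_alternatingWord j i (by rw [M.symmetric j i]; exact hcon.1)
        (by rw [M.symmetric j i]; exact hcon.2)
    have h2 := cs.length_wordProd_le (alternatingWord j i (n + 1))
    unfold CoxeterSystem.IsReduced at h1
    rw [length_alternatingWord] at h1 h2
    have h3 : w * cs.simple i = v * cs.wordProd (alternatingWord j i (n + 1)) := by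
      rw [alternatingWord_succ, wordProd_concat, hv, mul_assoc]
    have h4 := cs.length_mul_le v (cs.wordProd (alternatingWord j i (n + 1)))
    rw [← h3] at h4
    omega
  have hm1 := M.off_diagonal i j hij
  have u0 : 0 ≤ coefU (M i j) n := coefU_nonneg hm1 (hM.imp_right fun h => by omega)
  have u1 : 0 ≤ coefU (M i j) (n + 1) := coefU_nonneg hm1 hM
  rw [hv, map_mul, Module.End.mul_apply, geomRep_alternatingWord cs hij]
  split_ifs
  · rw [map_add, map_smul, map_smul]
    exact add_nonneg (smul_nonneg u0 rj) (smul_nonneg u1 ri)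
  · rw [map_add, map_smul, map_smul]
    exact add_nonneg (smul_nonneg u1 rj) (smul_nonneg u0 ri)

lemma geomRep_faithful (cs : CoxeterSystem M W) (w : W) (h : geomRep cs w = 1) : w = 1 := by
  by_contra hw
  obtain ⟨i, hi⟩ := cs.exists_rightDescent_of_ne_one hw
  have h1 := geomRep_nonneg cs _ (w * cs.simple i) i rfl
    (by simpa [CoxeterSystem.IsRightDescent] using hi)
  rw [map_mul, h, one_mul, geomRep_simple, geomRefl_root_self] at h1
  have := h1 i
  simp [root] at this
  linarith

lemma orderOf_simple_mul_simple (cs : CoxeterSystem M W) (i j : B) :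
    orderOf (cs.simple i * cs.simple j) = M i j := by
  apply Nat.dvd_antisymm
  · exact orderOf_dvd_of_pow_eq_one (cs.simple_mul_simple_pow i j)
  rcases eq_or_ne i j with rfl | hij
  · simp
  set k := orderOf (cs.simple i * cs.simple j)
  have hk : (cs.simple i * cs.simple j) ^ k = 1 := pow_orderOf_eq_one _
  have h1 := congrArg (geomRep cs) hk
  rw [map_pow, map_mul, geomRep_simple, geomRep_simple, map_one] at h1
  have h2 := LinearMap.congr_fun h1 (root i)
  rw [geomRefl_mul_pow_root M j i hij.symm, M.symmetric j i] at h2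
  apply dvd_of_coefU (M.off_diagonal i j hij)
  · have := DFunLike.congr_fun h2 j
    simpa [root, hij] using this
  · have := DFunLike.congr_fun h2 i
    simpa [root, hij.symm] using this

lemma simple_injective (cs : CoxeterSystem M W) : Function.Injective cs.simple := by
  intro i j h
  by_contra hij
  apply M.off_diagonal i j hij
  rw [← orderOf_simple_mul_simple cs, h]
  simp

/-- Restriction of a Coxeter matrix. -/
def restr (M : CoxeterMatrix B) (J : Set B) : CoxeterMatrix J where
  M := Matrix.of fun i j => M i j
  isSymm := by
    ext i j
    exact M.symmetric _ _
  diagonal i := M.diagonal _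
  off_diagonal i j h := M.off_diagonal _ _ (fun e => h (Subtype.ext e))

lemma restr_apply (J : Set B) (i j : J) : restr M J i j = M i j := rfl

/-- The map from the Coxeter group of the restricted matrix. -/
noncomputable def incl (cs : CoxeterSystem M W) (J : Set B) : (restr M J).Group →* W :=
  (restr M J).toCoxeterSystem.lift ⟨fun j => cs.simple j, fun i j => cs.simple_mul_simple_pow i j⟩

lemma incl_simple (cs : CoxeterSystem M W) (J : Set B) (j : J) :
    incl cs J ((restr M J).toCoxeterSystem.simple j) = cs.simple j :=
  (restr M J).toCoxeterSystem.lift_apply_simple (f := fun j : J => cs.simple j)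
    (fun i j => cs.simple_mul_simple_pow i j) j

lemma incl_injective (cs : CoxeterSystem M W) (J : Set B) : Function.Injective (incl cs J) := by
  rw [injective_iff_map_eq_one]
  intro g hg
  let e : (J →₀ ℝ) →ₗ[ℝ] (B →₀ ℝ) := Finsupp.lmapDomain ℝ ℝ Subtype.val
  have he : Function.Injective e := Finsupp.mapDomain_injective Subtype.val_injective
  have heroot : ∀ j : J, e (root j) = root (j : B) := fun j => by
    simp [e, root, Finsupp.mapDomain_single]
  have hform : ∀ j : J, geomForm M j ∘ₗ e = geomForm (restr M J) j := by
    intro j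
    apply Finsupp.lhom_ext'
    intro k
    ext
    change geomForm M j (e (root k)) = geomForm (restr M J) j (root k)
    rw [heroot, geomForm_root, geomForm_root, restr_apply]
  have key : ∀ x : (restr M J).Group, ∀ v,
      geomRep cs (incl cs J x) (e v) = e (geomRep (restr M J).toCoxeterSystem x v) := by
    intro x
    induction x using (restr M J).toCoxeterSystem.simple_induction_left with
    | one => simp
    | mul_simple_left x j ih =>
      intro v
      rw [map_mul, map_mul, map_mul, Module.End.mul_apply, Module.End.mul_apply, ih, incl_simple,
        geomRep_simple, geomRep_simple, geomRefl_apply, geomRefl_apply, map_sub, map_smul, heroot,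
        ← hform]
      rfl
  apply geomRep_faithful (restr M J).toCoxeterSystem
  refine LinearMap.ext fun v => he ?_
  rw [← key, hg]
  simp

lemma incl_range (cs : CoxeterSystem M W) (J : Set B) :
    (incl cs J).range = Subgroup.closure (cs.simple '' J) := by
  rw [MonoidHom.range_eq_map, ← (restr M J).toCoxeterSystem.subgroup_closure_range_simple,
    MonoidHom.map_closure]
  congr 1
  ext x
  constructor
  · rintro ⟨_, ⟨j, rfl⟩, rfl⟩
    exact ⟨j, j.2, (incl_simple cs J j).symm⟩
  · rintro ⟨j, hj, rfl⟩
    exact ⟨_, ⟨⟨j, hj⟩, rfl⟩, incl_simple cs J ⟨j, hj⟩⟩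

end Rep

lemma twist_liftable {G : Type} [Group G] (A B₀ : Set B) (σ : B → B) (N N' : CoxeterMatrix B)
    (t : B → G) (ht : N.IsLiftable t) (u : G)
    (hu : ∀ c, c ∉ A ∪ B₀ → u * t (σ c) * u⁻¹ = t c)
    (h0 : ∀ a ∈ A, ∀ b ∈ B₀, N' b a = 0)
    (h1 : ∀ b c, (b ∈ B₀ ↔ c ∈ B₀) → N' b c = N b c)
    (h2 : ∀ b c, b ∈ B₀ → c ∉ B₀ → N' b c = N b (σ c)) :
    N'.IsLiftable (fun b => if b ∈ B₀ then u * t b * u⁻¹ else t b) := by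
  have key : ∀ b c, b ∈ B₀ → c ∉ B₀ → (u * t b * u⁻¹ * t c) ^ N' b c = 1 := by
    intro b c hb hc
    by_cases hcA : c ∈ A
    · rw [h0 c hcA b hb, pow_zero]
    · have e : u * t b * u⁻¹ * t c = u * (t b * t (σ c)) * u⁻¹ := by
        rw [← hu c (by simp [hcA, hc])]
        group
      rw [e, conj_pow, h2 b c hb hc, ht]
      group
  intro b c
  by_cases hb : b ∈ B₀ <;> by_cases hc : c ∈ B₀
  · simp only [hb, hc, if_true]
    have e : u * t b * u⁻¹ * (u * t c * u⁻¹) = u * (t b * t c) * u⁻¹ := by group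
    rw [e, conj_pow, h1 b c (by simp [hb, hc]), ht]
    group
  · simp only [hb, hc, if_true, if_false]
    exact key b c hb hc
  · simp only [hb, hc, if_true, if_false]
    have e : t b * (u * t c * u⁻¹)
        = (u * t c * u⁻¹)⁻¹ * ((u * t c * u⁻¹) * t b) * ((u * t c * u⁻¹)⁻¹)⁻¹ := by group
    rw [e, conj_pow, N'.symmetric b c, key c b hc hb]
    group
  · simp only [hb, hc, if_false]
    rw [h1 b c (by simp [hb, hc]), ht]

lemma commute_of_two {N : CoxeterMatrix B} {G : Type} [Group G] (cs : CoxeterSystem N G) {c j : B}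
    (h : N c j = 2) : Commute (cs.simple c) (cs.simple j) := by
  have h1 := cs.simple_mul_simple_pow c j
  rw [h, pow_two] at h1
  have h2 := eq_inv_of_mul_eq_one_left h1
  rw [mul_inv_rev, cs.inv_simple, cs.inv_simple] at h2
  exact h2

/-- The twisted Coxeter matrix. -/
noncomputable def twistMatrix (M : CoxeterMatrix B) (B₀ : Set B) (σ : B → B) (hσ : ∀ c, c ∉ B₀ → σ c ∉ B₀) :
    CoxeterMatrix B where
  M := Matrix.of fun b c =>
    if b ∈ B₀ then (if c ∈ B₀ then M b c else M b (σ c))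
    else (if c ∈ B₀ then M (σ b) c else M b c)
  isSymm := by
    ext b c
    simp only [Matrix.transpose_apply, Matrix.of_apply]
    split_ifs <;> exact M.symmetric _ _
  diagonal b := by
    simp only [Matrix.of_apply]
    split_ifs <;> exact M.diagonal _
  off_diagonal b c h := by
    simp only [Matrix.of_apply]
    split_ifs with hb hc hc
    · exact M.off_diagonal _ _ h
    · exact M.off_diagonal _ _ (fun e => hσ c hc (e ▸ hb))
    · exact M.off_diagonal _ _ (fun e => hσ b hb (e ▸ hc))
    · exact M.off_diagonal _ _ h

lemma twistMatrix_apply (M : CoxeterMatrix B) (B₀ : Set B) (σ : B → B)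
    (hσ : ∀ c, c ∉ B₀ → σ c ∉ B₀) (b c : B) :
    twistMatrix M B₀ σ hσ b c = if b ∈ B₀ then (if c ∈ B₀ then M b c else M b (σ c))
    else (if c ∈ B₀ then M (σ b) c else M b c) := rfl

end FCTwist
/-- If `S` is a Coxeter generating set of type FC of the group `W` (encoded as a
Coxeter system `cs`), `J` is irreducible spherical and weakly separates `S` via the
partition `A ⊔ B₀` of `S ∖ (J ∪ J^⊥)` (no adjacency between `A` and `B₀`), and `τ` is
the corresponding elementary twist (conjugating `B₀` by the longest element `wJ` of
`⟨J⟩` and fixing everything else), then `τ(S)` is again a Coxeter generating set of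
`W`, and it is of type FC. -/
theorem fc_invariant_under_elementary_twist
    (M : CoxeterMatrix B) (cs : CoxeterSystem M W) (hFC : IsFC cs)
    (J A B₀ : Set B)
    (hsph : SphericalIdx cs J) (hirr : IrredIdx M J)
    (hunion : A ∪ B₀ = (J ∪ perpIdx M J)ᶜ) (hdisj : A ∩ B₀ = ∅)
    (hA : A.Nonempty) (hB : B₀.Nonempty)
    (hnoedge : ∀ a ∈ A, ∀ b ∈ B₀, M a b = 0)
    -- `wJ` is the longest element of `⟨J⟩`: an involution of `⟨J⟩` conjugating the
    -- simple reflections indexed by `J` to simple reflections indexed by `J`.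
    (wJ : W) (hwJmem : wJ ∈ Subgroup.closure (cs.simple '' J))
    (hwJinv : wJ * wJ = 1)
    (hwJconj : ∀ j ∈ J, ∃ j' ∈ J, wJ * cs.simple j * wJ⁻¹ = cs.simple j')
    (hwJlong : ∀ w ∈ Subgroup.closure (cs.simple '' J), cs.length w ≤ cs.length wJ) :
    ∃ (B' : Type) (M' : CoxeterMatrix B') (cs' : CoxeterSystem M' W),
      Set.range cs'.simple =
        Set.range (fun b : B =>
          if b ∈ B₀ then wJ * cs.simple b * wJ⁻¹ else cs.simple b) ∧
      IsFC cs' := by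
  have hmem : ∀ c, c ∉ A ∪ B₀ ↔ c ∈ J ∪ perpIdx M J := by
    intro c
    rw [hunion, Set.mem_compl_iff, not_not]
  have hwinv : wJ⁻¹ = wJ := inv_eq_of_mul_eq_one_left hwJinv
  have hBJ : ∀ c ∈ J, c ∉ B₀ := fun c hc hcB =>
    (hmem c).2 (Or.inl hc) (Or.inr hcB)
  have hBperp : ∀ c ∈ perpIdx M J, c ∉ B₀ := fun c hc hcB =>
    (hmem c).2 (Or.inr hc) (Or.inr hcB)
  have hAJ : ∀ c ∈ J, c ∉ A := fun c hc hcB =>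
    (hmem c).2 (Or.inl hc) (Or.inl hcB)
  have hAB : ∀ a ∈ A, a ∉ B₀ := fun a ha hb => by
    have : a ∈ A ∩ B₀ := ⟨ha, hb⟩
    rw [hdisj] at this
    exact this
  -- the permutation of the generators induced by `wJ`
  choose! σ₀ hσ₀J hσ₀ using hwJconj
  let σ : B → B := fun b => if b ∈ J then σ₀ b else b
  have hσin : ∀ b ∈ J, σ b = σ₀ b := fun b hb => if_pos hb
  have hσout : ∀ b, b ∉ J → σ b = b := fun b hb => if_neg hb
  have hσJ : ∀ b ∈ J, σ b ∈ J := fun b hb => by rw [hσin b hb]; exact hσ₀J b hb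
  have hσσ : ∀ b, σ (σ b) = b := by
    intro b
    by_cases hb : b ∈ J
    · apply FCTwist.simple_injective cs
      rw [hσin _ (hσJ b hb), ← hσ₀ _ (hσJ b hb), hσin b hb, ← hσ₀ b hb, hwinv]
      calc wJ * (wJ * cs.simple b * wJ) * wJ = (wJ * wJ) * cs.simple b * (wJ * wJ) := by group
        _ = cs.simple b := by rw [hwJinv]; simp
    · rw [hσout b hb, hσout b hb]
  have hσB : ∀ c, c ∉ B₀ → σ c ∉ B₀ := by
    intro c hc
    by_cases h : c ∈ J
    · exact hBJ _ (hσJ c h)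
    · rwa [hσout c h]
  have hwperp : ∀ c ∈ perpIdx M J, Commute (cs.simple c) wJ := by
    intro c hc
    have hle : Subgroup.closure (cs.simple '' J) ≤ Subgroup.centralizer {cs.simple c} := by
      rw [Subgroup.closure_le]
      rintro _ ⟨j, hj, rfl⟩
      simp only [SetLike.mem_coe, Subgroup.mem_centralizer_singleton_iff]
      exact ((FCTwist.commute_of_two cs (hc.2 j hj))).eq.symm
    have := hle hwJmem
    rw [Subgroup.mem_centralizer_singleton_iff] at this
    exact this.symm
  have hconj : ∀ c, c ∉ A ∪ B₀ → wJ * cs.simple (σ c) * wJ⁻¹ = cs.simple c := by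
    intro c hc
    rcases (hmem c).1 hc with h | h
    · have := hσ₀ _ (hσJ c h)
      rw [this, ← hσin _ (hσJ c h), hσσ]
    · rw [hσout c h.1, ← (hwperp c h).eq, mul_inv_cancel_right]
  let M' := FCTwist.twistMatrix M B₀ σ hσB
  have hM' : ∀ b c, M' b c = if b ∈ B₀ then (if c ∈ B₀ then M b c else M b (σ c))
    else (if c ∈ B₀ then M (σ b) c else M b c) := fun b c => rfl
  have hM'same : ∀ b c, (b ∈ B₀ ↔ c ∈ B₀) → M' b c = M b c := by
    intro b c h
    rw [hM']
    by_cases hb : b ∈ B₀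
    · rw [if_pos hb, if_pos (h.1 hb)]
    · rw [if_neg hb, if_neg (fun hc => hb (h.2 hc))]
  have hM'diff : ∀ b c, b ∈ B₀ → c ∉ B₀ → M' b c = M b (σ c) := by
    intro b c hb hc
    rw [hM', if_pos hb, if_neg hc]
  have hM'0 : ∀ a ∈ A, ∀ b ∈ B₀, M' b a = 0 := by
    intro a ha b hb
    rw [hM'diff b a hb (hAB a ha), hσout a (fun h => hAJ a h ha), M.symmetric b a, hnoedge a ha b hb]
  let ct := M'.toCoxeterSystem
  have hφ := FCTwist.twist_liftable A B₀ σ M M' cs.simple cs.simple_mul_simple_pow wJ hconj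
    hM'0 hM'same hM'diff
  let φ : M'.Group →* W := ct.lift ⟨_, hφ⟩
  have hφs : ∀ b, φ (ct.simple b) = if b ∈ B₀ then wJ * cs.simple b * wJ⁻¹ else cs.simple b :=
    fun b => ct.lift_apply_simple hφ b
  -- the element of the new Coxeter group corresponding to `wJ`
  let cJ := (FCTwist.restr M J).toCoxeterSystem
  have hI : (FCTwist.restr M J).IsLiftable (fun j : J => ct.simple j) := by
    intro i j
    have := ct.simple_mul_simple_pow i j
    rw [hM'same _ _ (by simp [hBJ i i.2, hBJ j j.2])] at this
    exact this
  let I : (FCTwist.restr M J).Group →* M'.Group := cJ.lift ⟨_, hI⟩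
  have hIs : ∀ j : J, I (cJ.simple j) = ct.simple j := fun j => cJ.lift_apply_simple hI j
  obtain ⟨w₀, hw₀⟩ : ∃ w₀, FCTwist.incl cs J w₀ = wJ := by
    rw [← FCTwist.incl_range] at hwJmem
    exact hwJmem
  have hincl : ∀ j : J, FCTwist.incl cs J (cJ.simple j) = cs.simple j := FCTwist.incl_simple cs J
  have hw₀sq : w₀ * w₀ = 1 := by
    apply FCTwist.incl_injective cs J
    rw [map_mul, hw₀, hwJinv, map_one]
  have hw₀conj : ∀ j : J, w₀ * cJ.simple ⟨σ j, hσJ j j.2⟩ * w₀⁻¹ = cJ.simple j := by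
    intro j
    apply FCTwist.incl_injective cs J
    rw [map_mul, map_mul, map_inv, hw₀, hincl, hincl]
    exact hconj j ((hmem j).2 (Or.inl j.2))
  set w' := I w₀ with hw'
  have hw'sq : w' * w' = 1 := by rw [hw', ← map_mul, hw₀sq, map_one]
  have hIperp : ∀ c ∈ perpIdx M J, ∀ x, Commute (ct.simple c) (I x) := by
    intro c hc x
    induction x using cJ.simple_induction_left with
    | one => rw [map_one]; exact Commute.one_right _
    | mul_simple_left x j ih =>
      rw [map_mul, hIs]
      refine Commute.mul_right (FCTwist.commute_of_two ct ?_) ih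
      rw [hM'same _ _ (by simp [hBperp c hc, hBJ j j.2])]
      exact hc.2 j j.2
  have hconj' : ∀ c, c ∉ A ∪ B₀ → w' * ct.simple (σ c) * w'⁻¹ = ct.simple c := by
    intro c hc
    rcases (hmem c).1 hc with h | h
    · have := congrArg I (hw₀conj ⟨c, h⟩)
      rw [map_mul, map_mul, map_inv, hIs, hIs] at this
      exact this
    · rw [hσout c h.1, ← (hIperp c h w₀).eq, mul_inv_cancel_right]
  have hψ := FCTwist.twist_liftable A B₀ σ M' M ct.simple ct.simple_mul_simple_pow w' hconj'
    (fun a ha b hb => by rw [M.symmetric b a]; exact hnoedge a ha b hb)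
    (fun b c h => (hM'same b c h).symm)
    (fun b c hb hc => by rw [hM'diff b (σ c) hb (hσB c hc), hσσ])
  let ψ : W →* M'.Group := cs.lift ⟨_, hψ⟩
  have hψs : ∀ b, ψ (cs.simple b) = if b ∈ B₀ then w' * ct.simple b * w'⁻¹ else ct.simple b :=
    fun b => cs.lift_apply_simple hψ b
  have hψw : ψ wJ = w' := by
    have : ψ.comp (FCTwist.incl cs J) = I := by
      apply cJ.ext_simple
      intro j
      rw [MonoidHom.comp_apply, hincl, hψs, if_neg (hBJ j j.2), hIs]
    rw [← hw₀, ← MonoidHom.comp_apply, this]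
  have hφw : φ w' = wJ := by
    have : φ.comp I = FCTwist.incl cs J := by
      apply cJ.ext_simple
      intro j
      rw [MonoidHom.comp_apply, hIs, hφs, if_neg (hBJ j j.2), hincl]
    rw [hw', ← MonoidHom.comp_apply, this, hw₀]
  have hψφ : ψ.comp φ = MonoidHom.id _ := by
    apply ct.ext_simple
    intro b
    rw [MonoidHom.comp_apply, hφs, MonoidHom.id_apply]
    by_cases hb : b ∈ B₀
    · rw [if_pos hb, map_mul, map_mul, map_inv, hψw, hψs, if_pos hb,
        inv_eq_of_mul_eq_one_left hw'sq]
      calc w' * (w' * ct.simple b * w') * w' = (w' * w') * ct.simple b * (w' * w') := by group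
        _ = ct.simple b := by rw [hw'sq]; simp
    · rw [if_neg hb, hψs, if_neg hb]
  have hφψ : φ.comp ψ = MonoidHom.id _ := by
    apply cs.ext_simple
    intro b
    rw [MonoidHom.comp_apply, hψs, MonoidHom.id_apply]
    by_cases hb : b ∈ B₀
    · rw [if_pos hb, map_mul, map_mul, map_inv, hφw, hφs, if_pos hb, hwinv]
      calc wJ * (wJ * cs.simple b * wJ) * wJ = (wJ * wJ) * cs.simple b * (wJ * wJ) := by group
        _ = cs.simple b := by rw [hwJinv]; simp
    · rw [if_neg hb, hφs, if_neg hb]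
  let cs' : CoxeterSystem M' W := ct.map (MonoidHom.toMulEquiv φ ψ hψφ hφψ)
  have hcs' : ∀ b, cs'.simple b = if b ∈ B₀ then wJ * cs.simple b * wJ⁻¹ else cs.simple b := hφs
  refine ⟨B, M', cs', congrArg Set.range (funext hcs'), ?_⟩
  intro K hK
  by_cases hKB : ∃ b₀ ∈ K, b₀ ∈ B₀
  · obtain ⟨b₀, hb₀K, hb₀⟩ := hKB
    have hKA : ∀ c ∈ K, c ∉ A := by
      intro c hc hcA
      exact hK b₀ hb₀K c hc (fun e => hAB c hcA (e ▸ hb₀)) (hM'0 c hcA b₀ hb₀)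
    have hσB₀ : ∀ b ∈ B₀, σ b = b := fun b hb => hσout b (fun h => hBJ b h hb)
    have himg : cs'.simple '' K = (MulAut.conj wJ).toMonoidHom '' (cs.simple '' (σ '' K)) := by
      rw [Set.image_image, Set.image_image]
      apply Set.image_congr
      intro b hb
      rw [hcs']
      by_cases hbB : b ∈ B₀
      · rw [if_pos hbB, hσB₀ b hbB]
        rfl
      · rw [if_neg hbB, ← hconj b (by simp [hKA b hb, hbB])]
        rfl
    have hMσ : ∀ b c, b ∉ A ∪ B₀ → c ∉ A ∪ B₀ → M (σ b) (σ c) = M b c := by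
      intro b c hb hc
      rw [← FCTwist.orderOf_simple_mul_simple cs b c, ← hconj b hb, ← hconj c hc,
        ← FCTwist.orderOf_simple_mul_simple cs (σ b) (σ c)]
      have e : wJ * cs.simple (σ b) * wJ⁻¹ * (wJ * cs.simple (σ c) * wJ⁻¹)
          = MulAut.conj wJ (cs.simple (σ b) * cs.simple (σ c)) := by
        rw [MulAut.conj_apply]; group
      rw [e]
      exact (orderOf_injective (MulAut.conj wJ).toMonoidHom (MulAut.conj wJ).injective _).symm
    have hfin : SphericalIdx cs (σ '' K) := by
      apply hFC
      rintro _ ⟨b, hb, rfl⟩ _ ⟨c, hc, rfl⟩ hne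
      have h := hK b hb c hc (fun e => hne (e ▸ rfl))
      by_cases hbB : b ∈ B₀ <;> by_cases hcB : c ∈ B₀
      · rw [hM'same _ _ (by simp [hbB, hcB])] at h
        rwa [hσB₀ b hbB, hσB₀ c hcB]
      · rw [hM'diff b c hbB hcB] at h
        rwa [hσB₀ b hbB]
      · rw [M'.symmetric, hM'diff c b hcB hbB, M.symmetric] at h
        rwa [hσB₀ c hcB]
      · rw [hM'same _ _ (by simp [hbB, hcB])] at h
        rwa [hMσ b c (by simp [hKA b hb, hbB]) (by simp [hKA c hc, hcB])]
    unfold SphericalIdx at hfin ⊢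
    rw [himg, ← MonoidHom.map_closure, Subgroup.coe_map]
    exact hfin.image _
  · have hKB' : ∀ b ∈ K, b ∉ B₀ := fun b hb h => hKB ⟨b, hb, h⟩
    have himg : cs'.simple '' K = cs.simple '' K := by
      apply Set.image_congr
      intro b hb
      rw [hcs', if_neg (hKB' b hb)]
    unfold SphericalIdx
    rw [himg]
    apply hFC
    intro b hb c hc hne
    have h := hK b hb c hc hne
    rwa [hM'same _ _ (by simp [hKB' b hb, hKB' c hc])] at h
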